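/- Fix b>0, κ∈ℕ and p∈(0,1). Then the rate functions I_{L,MC} and I_{G,MC} are nonnegative, and each of them vanishes at exactly one point, namely (a,s) = (pb, pb·e^{−bp/κ}). In particular this pair is the unique minimizer of both I_{L,MC} and I_{G,MC}. -/

import Mathlib

open scoped BigOperators

/-- The Poisson probability mass function with parameter `l`. -/
noncomputable def poissonPMF (l : ℝ) (k : ℕ) : ℝ := Real.exp (-l) * l ^ k / (Nat.factorial k : ℝ)

/-- The binomial probability mass function with parameters `n` and `q`. -/
noncomputable def binPMF (n : ℕ) (q : ℝ) (k : ℕ) : ℝ :=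
  (n.choose k : ℝ) * q ^ k * (1 - q) ^ (n - k)

/-- `μ` is a probability mass function. -/
def IsPMF {α : Type*} (μ : α → ℝ) : Prop := (∀ x, 0 ≤ μ x) ∧ HasSum μ 1

-- Relative entropy `H(μ | ν)`, equal to `⊤` if `μ` is not absolutely continuous
-- with respect to `ν` or if the defining series diverges (to `+∞`).
open Classical in
noncomputable def relEnt {α : Type*} (μ ν : α → ℝ) : EReal :=
  if (∀ x, ν x = 0 → μ x = 0) ∧ Summable (fun x => μ x * Real.log (μ x / ν x))
  then ((∑' x, μ x * Real.log (μ x / ν x) : ℝ) : EReal) else ⊤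


/-- Extended-real-valued logarithm: `elog x = log x` for `x > 0` and `⊥` for `x ≤ 0`. -/
noncomputable def elog (x : ℝ) : EReal := if x ≤ 0 then ⊥ else ((Real.log x : ℝ) : EReal)

/-- The reference measure `M(i,j)`: the probability that `κ` i.i.d. `Poi_{l}` variables
have sum `i` and that exactly `j` of them are equal to `1`. -/
noncomputable def Mref (l : ℝ) (κ : ℕ) (i j : ℕ) : ℝ :=
  ∑' y : Fin κ → ℕ,
    if (∑ k, y k) = i ∧ (Finset.univ.filter (fun k => y k = 1)).card = j
    then ∏ k, poissonPMF l (y k) else 0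

/-- The rate function `I_{L,MC}` of the local-rule multi-channel model:
`I(a,s) = inf { H(ν | M) : ν` a probability measure on
`Ξ = {(i,j) : j ≤ i, j ≤ κ}` with `Σ ν(i,j) i = a, Σ ν(i,j) j = s }`, with `inf ∅ = ⊤`. -/
noncomputable def ILMC (b p : ℝ) (κ : ℕ) (a s : ℝ) : EReal :=
  sInf { h : EReal | ∃ ν : ℕ × ℕ → ℝ, IsPMF ν ∧
      (∀ x : ℕ × ℕ, ¬(x.2 ≤ x.1 ∧ x.2 ≤ κ) → ν x = 0) ∧
      HasSum (fun x : ℕ × ℕ => (x.1 : ℝ) * ν x) a ∧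
      HasSum (fun x : ℕ × ℕ => (x.2 : ℝ) * ν x) s ∧
      h = relEnt ν (fun x : ℕ × ℕ => Mref (b * p / κ) κ x.1 x.2) }


/-- The rate function `I_{G,MC}` of the global-rule multi-channel model
(for `a ∈ (0,b)`). -/
noncomputable def IGMC (b p : ℝ) (κ : ℕ) (a s : ℝ) : EReal :=
  (κ : EReal) * sInf { h : EReal | ∃ μ : ℕ → ℝ, IsPMF μ ∧
      HasSum (fun g : ℕ => (g : ℝ) * μ g) (a / κ) ∧
      μ 1 = s / κ ∧
      h = relEnt μ (poissonPMF (b * p / κ)) }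
    + ((a - b * p + (b - a) * Real.log ((1 - a / b) / (1 - p)) : ℝ) : EReal)

theorem aux_congr {α : Type*} {f g : α → ℝ} {a b : ℝ} (h : HasSum f a) (h1 : ∀ x, g x = f x)
    (h2 : b = a) : HasSum g b := by
  obtain rfl : g = f := funext h1
  subst h2
  exact h


theorem aux_relEnt_lb {α : Type*} (μ ν f : α → ℝ) (F Z : ℝ) (hμ : IsPMF μ) (hν : ∀ x, 0 ≤ ν x)
    (hF : HasSum (fun x => f x * μ x) F) (hZ : HasSum (fun x => ν x * Real.exp (f x)) Z) :
    ((F - (Z - 1) : ℝ) : EReal) ≤ relEnt μ ν := by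
  unfold relEnt
  split_ifs with h
  · obtain ⟨hac, hs⟩ := h
    rw [EReal.coe_le_coe_iff]
    have h1 := hF.sub hs.hasSum
    have h2 := hZ.sub hμ.2
    have := hasSum_le (fun x => ?_) h1 h2
    · linarith
    · rcases (hμ.1 x).eq_or_lt with h0 | h0
      · simp only [← h0]
        have := mul_nonneg (hν x) (Real.exp_pos (f x)).le
        simpa using this
      · have hn : 0 < ν x := lt_of_le_of_ne (hν x) (fun h' => h0.ne' (hac x h'.symm))
        have h3 := Real.log_le_sub_one_of_pos
          (show 0 < ν x * Real.exp (f x) / μ x by positivity)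
        rw [Real.log_div (by positivity) h0.ne', Real.log_mul hn.ne' (by positivity),
          Real.log_exp] at h3
        rw [Real.log_div h0.ne' hn.ne']
        have h4 := mul_le_mul_of_nonneg_left h3 h0.le
        have h5 : μ x * (ν x * Real.exp (f x) / μ x - 1) = ν x * Real.exp (f x) - μ x := by
          field_simp
        rw [h5] at h4
        linarith
  · exact le_top

theorem aux_relEnt_self {α : Type*} (μ : α → ℝ) : relEnt μ μ = 0 := by
  have h : ∀ x, μ x * Real.log (μ x / μ x) = 0 := by
    intro x
    by_cases h : μ x = 0
    · simp [h]
    · simp [div_self h]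
  unfold relEnt
  rw [if_pos]
  · simp [h]
  · simp [h, summable_zero]

theorem aux_deriv (φ : ℝ → ℝ) (A d : ℝ) (h0 : φ 0 = 0) (hd : HasDerivAt φ d 0)
    (h : ∀ t, t * A ≤ φ t) : A = d := by
  have h1 : HasDerivAt (fun t => φ t - t * A) (d - 1 * A) 0 :=
    hd.sub ((hasDerivAt_id (0:ℝ)).mul_const A)
  have h2 : IsLocalMin (fun t => φ t - t * A) 0 := by
    refine Filter.Eventually.of_forall (fun t => ?_)
    have := h t
    simp only [h0]
    linarith
  have := h2.hasDerivAt_eq_zero h1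
  linarith

theorem aux_pois_nonneg {l : ℝ} (hl : 0 ≤ l) (n : ℕ) : 0 ≤ poissonPMF l n := by
  unfold poissonPMF; positivity

theorem aux_pois_exp (l t : ℝ) :
    HasSum (fun n : ℕ => poissonPMF l n * Real.exp (t * n)) (Real.exp (l * (Real.exp t - 1))) := by
  have h := NormedSpace.expSeries_div_hasSum_exp (𝔸 := ℝ) (l * Real.exp t)
  rw [← Real.exp_eq_exp_ℝ] at h
  have h2 := h.mul_left (Real.exp (-l))
  rw [← Real.exp_add] at h2
  refine aux_congr h2 ?_ ?_
  · intro n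
    unfold poissonPMF
    rw [mul_comm t, Real.exp_nat_mul, mul_pow]
    ring
  · congr 1; ring

theorem aux_pois_sum (l : ℝ) : HasSum (poissonPMF l) 1 := by
  simpa using aux_pois_exp l 0

theorem aux_pois_mean (l : ℝ) : HasSum (fun n : ℕ => (n : ℝ) * poissonPMF l n) l := by
  rw [← hasSum_nat_add_iff' 1]
  have h := (aux_pois_sum l).mul_left l
  simp only [Finset.range_one, Finset.sum_singleton, Nat.cast_zero, zero_mul, sub_zero]
  refine aux_congr h ?_ ?_
  · intro n
    unfold poissonPMF
    rw [Nat.factorial_succ]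
    push_cast
    have : (n : ℝ) + 1 ≠ 0 := by positivity
    field_simp
    ring
  · ring

theorem aux_pois_one (l : ℝ) : poissonPMF l 1 = l * Real.exp (-l) := by
  simp [poissonPMF, mul_comm]

theorem aux_ind (μ : ℕ → ℝ) : HasSum (fun n : ℕ => (if n = 1 then (1:ℝ) else 0) * μ n) (μ 1) := by
  have := hasSum_single (f := fun n : ℕ => (if n = 1 then (1:ℝ) else 0) * μ n) 1
    (fun n hn => by simp [hn])
  simpa using this

theorem aux_pois_ind_exp (l t : ℝ) :
    HasSum (fun n : ℕ => poissonPMF l n * Real.exp (t * (if n = 1 then (1:ℝ) else 0)))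
      (1 + l * Real.exp (-l) * (Real.exp t - 1)) := by
  have h := (aux_pois_sum l).add ((aux_ind (poissonPMF l)).mul_right (Real.exp t - 1))
  rw [aux_pois_one] at h
  refine aux_congr h ?_ rfl
  intro n
  by_cases hn : n = 1
  · simp [hn]; ring
  · simp [hn]

theorem aux_mul {α β : Type} (f : α → ℝ) (g : β → ℝ) (s t : ℝ) (hf : 0 ≤ f) (hg : 0 ≤ g)
    (h1 : HasSum f s) (h2 : HasSum g t) : HasSum (fun x : α × β => f x.1 * g x.2) (s * t) :=
  h1.mul h2 (h1.summable.mul_of_nonneg h2.summable hf hg)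

theorem aux_pi (n : ℕ) (g : Fin n → ℕ → ℝ) (S : Fin n → ℝ) (h0 : ∀ k m, 0 ≤ g k m)
    (h : ∀ k, HasSum (g k) (S k)) :
    HasSum (fun y : Fin n → ℕ => ∏ k, g k (y k)) (∏ k, S k) := by
  induction n with
  | zero =>
    simpa using hasSum_unique (fun y : Fin 0 → ℕ => (1:ℝ))
  | succ n ih =>
    have h1 : HasSum (fun y : Fin n → ℕ => ∏ k : Fin n, g (Fin.succ k) (y k))
        (∏ k : Fin n, S (Fin.succ k)) :=
      ih (fun k => g (Fin.succ k)) (fun k => S (Fin.succ k)) (fun k m => h0 _ m) (fun k => h _)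
    have h4 : ∀ y : Fin n → ℕ, 0 ≤ ∏ k : Fin n, g (Fin.succ k) (y k) :=
      fun y => Finset.prod_nonneg (fun k _ => h0 _ _)
    have hz := h 0
    have hz0 := h0 0
    rw [← (Fin.consEquiv (fun _ : Fin (n+1) => ℕ)).hasSum_iff, Fin.prod_univ_succ]
    generalize hP : (∏ k : Fin n, S (Fin.succ k)) = P at *
    generalize hG : (fun y : Fin n → ℕ => ∏ k : Fin n, g (Fin.succ k) (y k)) = G at *
    have h4' : ∀ y, 0 ≤ G y := by
      intro y
      rw [← hG]
      exact h4 y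
    have h2 := aux_mul (g 0) G (S 0) P hz0 h4' hz h1
    subst hG
    refine aux_congr h2 ?_ rfl
    intro x
    simp only [Function.comp, Fin.prod_univ_succ, Fin.consEquiv, Equiv.coe_fn_mk, Fin.cons_zero, Fin.cons_succ]

/-- The statistic (sum, number of ones). -/
def auxT (κ : ℕ) (y : Fin κ → ℕ) : ℕ × ℕ :=
  (∑ k, y k, (Finset.univ.filter (fun k => y k = 1)).card)

theorem aux_push (l : ℝ) (κ : ℕ) (F : ℕ × ℕ → ℝ) (Z : ℝ)
    (h : HasSum (fun y : Fin κ → ℕ => F (auxT κ y) * ∏ k, poissonPMF l (y k)) Z) :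
    HasSum (fun x : ℕ × ℕ => F x * Mref l κ x.1 x.2) Z := by
  have h1 := h.tsum_fiberwise (auxT κ)
  refine aux_congr h1 ?_ rfl
  intro c
  rw [tsum_subtype (auxT κ ⁻¹' {c}) (fun y => F (auxT κ y) * ∏ k, poissonPMF l (y k))]
  unfold Mref
  rw [← tsum_mul_left]
  congr 1
  funext y
  by_cases hy : auxT κ y = c
  · rw [Set.indicator_of_mem (by simpa using hy), hy, if_pos]
    rw [← hy]; exact ⟨rfl, rfl⟩
  · rw [Set.indicator_of_notMem (by simpa using hy), if_neg, mul_zero]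
    rintro ⟨h1, h2⟩
    exact hy (Prod.ext h1 h2)

theorem aux_M_nonneg {l : ℝ} (hl : 0 ≤ l) (κ i j : ℕ) : 0 ≤ Mref l κ i j := by
  unfold Mref
  refine tsum_nonneg (fun y => ?_)
  split_ifs
  · exact Finset.prod_nonneg (fun k _ => aux_pois_nonneg hl _)
  · exact le_rfl

theorem aux_M_supp (l : ℝ) (κ i j : ℕ) (h : ¬ (j ≤ i ∧ j ≤ κ)) : Mref l κ i j = 0 := by
  unfold Mref
  convert tsum_zero with y
  rw [if_neg]
  rintro ⟨rfl, rfl⟩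
  apply h
  constructor
  · rw [Finset.card_filter]
    refine Finset.sum_le_sum (fun k _ => ?_)
    split_ifs <;> omega
  · simpa using Finset.card_filter_le (Finset.univ : Finset (Fin κ)) _

theorem aux_exp_add {l : ℝ} (hl : 0 ≤ l) (κ : ℕ) (u : ℕ → ℝ) (t E : ℝ)
    (h : HasSum (fun n => poissonPMF l n * Real.exp (t * u n)) E) :
    HasSum (fun y : Fin κ → ℕ => Real.exp (t * ∑ k, u (y k)) * ∏ k, poissonPMF l (y k))
      (E ^ κ) := by
  have := aux_pi κ (fun _ n => poissonPMF l n * Real.exp (t * u n)) (fun _ => E)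
    (fun k m => mul_nonneg (aux_pois_nonneg hl m) (Real.exp_pos _).le) (fun _ => h)
  refine aux_congr this ?_ ?_
  · intro y
    rw [Finset.prod_mul_distrib, ← Real.exp_sum, Finset.mul_sum, mul_comm]
  · simp

theorem aux_mean_add {l : ℝ} (hl : 0 ≤ l) (κ : ℕ) (u : ℕ → ℝ) (hu : ∀ n, 0 ≤ u n) (E : ℝ)
    (h : HasSum (fun n => u n * poissonPMF l n) E) :
    HasSum (fun y : Fin κ → ℕ => (∑ k, u (y k)) * ∏ k, poissonPMF l (y k)) (κ * E) := by
  have h1 : ∀ j : Fin κ, HasSum (fun y : Fin κ → ℕ => u (y j) * ∏ k, poissonPMF l (y k)) E := by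
    intro j
    have := aux_pi κ (fun k n => (if k = j then u n else 1) * poissonPMF l n)
      (fun k => if k = j then E else 1)
      (fun k m => mul_nonneg (by split_ifs; exacts [hu m, zero_le_one]) (aux_pois_nonneg hl m))
      (fun k => by
        by_cases hk : k = j
        · simpa [hk] using h
        · simpa [hk] using aux_pois_sum l)
    refine aux_congr this ?_ ?_
    · intro y
      rw [Finset.prod_mul_distrib]
      simp
    · simp
  have := hasSum_sum (s := Finset.univ) (fun j _ => h1 j)
  refine aux_congr this ?_ ?_
  · intro y
    rw [Finset.sum_mul]
  · simp

theorem aux_T1 (κ : ℕ) (y : Fin κ → ℕ) : ((auxT κ y).1 : ℝ) = ∑ k, (y k : ℝ) := by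
  simp [auxT]

theorem aux_T2 (κ : ℕ) (y : Fin κ → ℕ) :
    ((auxT κ y).2 : ℝ) = ∑ k, (if y k = 1 then (1:ℝ) else 0) := by
  simp [auxT]

theorem aux_M_mean1 {l : ℝ} (hl : 0 ≤ l) (κ : ℕ) :
    HasSum (fun x : ℕ × ℕ => (x.1 : ℝ) * Mref l κ x.1 x.2) (κ * l) := by
  apply aux_push l κ (fun x => (x.1 : ℝ))
  simp only [aux_T1]
  exact aux_mean_add hl κ (fun n => (n:ℝ)) (fun n => by positivity) l (aux_pois_mean l)

theorem aux_M_mean2 {l : ℝ} (hl : 0 ≤ l) (κ : ℕ) :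
    HasSum (fun x : ℕ × ℕ => (x.2 : ℝ) * Mref l κ x.1 x.2) (κ * (l * Real.exp (-l))) := by
  apply aux_push l κ (fun x => (x.2 : ℝ))
  simp only [aux_T2]
  refine aux_mean_add hl κ (fun n => if n = 1 then (1:ℝ) else 0)
    (fun n => by positivity) _ ?_
  rw [← aux_pois_one]
  exact aux_ind _

theorem aux_M_exp1 {l : ℝ} (hl : 0 ≤ l) (κ : ℕ) (t : ℝ) :
    HasSum (fun x : ℕ × ℕ => Mref l κ x.1 x.2 * Real.exp (t * x.1))
      (Real.exp (l * (Real.exp t - 1)) ^ κ) := by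
  have := aux_push l κ (fun x => Real.exp (t * x.1)) (Real.exp (l * (Real.exp t - 1)) ^ κ) (by
    simp only [aux_T1]
    exact aux_exp_add hl κ (fun n => (n:ℝ)) t _ (aux_pois_exp l t))
  simpa only [mul_comm] using this

theorem aux_M_exp2 {l : ℝ} (hl : 0 ≤ l) (κ : ℕ) (t : ℝ) :
    HasSum (fun x : ℕ × ℕ => Mref l κ x.1 x.2 * Real.exp (t * x.2))
      ((1 + l * Real.exp (-l) * (Real.exp t - 1)) ^ κ) := by
  have := aux_push l κ (fun x => Real.exp (t * x.2))
    ((1 + l * Real.exp (-l) * (Real.exp t - 1)) ^ κ) (by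
    simp only [aux_T2]
    exact aux_exp_add hl κ (fun n => if n = 1 then (1:ℝ) else 0) t _ (aux_pois_ind_exp l t))
  refine aux_congr this ?_ rfl
  intro x
  ring

theorem aux_M_pmf {l : ℝ} (hl : 0 ≤ l) (κ : ℕ) :
    IsPMF (fun x : ℕ × ℕ => Mref l κ x.1 x.2) :=
  ⟨fun x => aux_M_nonneg hl _ _ _, by simpa using aux_M_exp1 hl κ 0⟩

theorem aux_L_lb1 {b p : ℝ} {κ : ℕ} (hl : 0 ≤ b * p / κ) (a s t : ℝ) :
    ((t * a - (Real.exp (b * p / κ * (Real.exp t - 1)) ^ κ - 1) : ℝ) : EReal) ≤ ILMC b p κ a s := by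
  refine le_sInf ?_
  rintro h ⟨ν, hν, -, h1, h2, rfl⟩
  refine aux_relEnt_lb ν _ (fun x => t * x.1) _ _ hν (fun x => aux_M_nonneg hl _ _ _) ?_
    (aux_M_exp1 hl κ t)
  simpa only [mul_assoc] using h1.mul_left t

theorem aux_L_lb2 {b p : ℝ} {κ : ℕ} (hl : 0 ≤ b * p / κ) (a s t : ℝ) :
    ((t * s - ((1 + b * p / κ * Real.exp (-(b * p / κ)) * (Real.exp t - 1)) ^ κ - 1) : ℝ) : EReal)
      ≤ ILMC b p κ a s := by
  refine le_sInf ?_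
  rintro h ⟨ν, hν, -, h1, h2, rfl⟩
  refine aux_relEnt_lb ν _ (fun x => t * x.2) _ _ hν (fun x => aux_M_nonneg hl _ _ _) ?_
    (aux_M_exp2 hl κ t)
  simpa only [mul_assoc] using h2.mul_left t

/-- Inner infimum of the global rate function. -/
noncomputable def auxJ (b p : ℝ) (κ : ℕ) (a s : ℝ) : EReal :=
  sInf { h : EReal | ∃ μ : ℕ → ℝ, IsPMF μ ∧
      HasSum (fun g : ℕ => (g : ℝ) * μ g) (a / κ) ∧
      μ 1 = s / κ ∧
      h = relEnt μ (poissonPMF (b * p / κ)) }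

theorem aux_G_lb1 {b p : ℝ} {κ : ℕ} (hl : 0 ≤ b * p / κ) (a s t : ℝ) :
    ((t * (a / κ) - b * p / κ * (Real.exp t - 1) : ℝ) : EReal) ≤ auxJ b p κ a s := by
  refine le_sInf ?_
  rintro h ⟨μ, hμ, h1, h2, rfl⟩
  have := aux_relEnt_lb μ (poissonPMF (b * p / κ))
    (fun x => t * x - b * p / κ * (Real.exp t - 1))
    (t * (a / κ) - b * p / κ * (Real.exp t - 1)) 1 hμ (fun x => aux_pois_nonneg hl _) ?_ ?_
  · simpa using this
  · have h3 := (h1.mul_left t).sub (hμ.2.mul_left (b * p / κ * (Real.exp t - 1)))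
    refine aux_congr h3 ?_ ?_
    · intro x; ring
    · ring
  · have h3 := (aux_pois_exp (b * p / κ) t).mul_right
      (Real.exp (-(b * p / κ * (Real.exp t - 1))))
    rw [← Real.exp_add, add_neg_cancel, Real.exp_zero] at h3
    refine aux_congr h3 ?_ rfl
    intro x
    rw [mul_assoc, ← Real.exp_add, sub_eq_add_neg]

theorem aux_G_lb2 {b p : ℝ} {κ : ℕ} (hl : 0 ≤ b * p / κ) (a s t : ℝ) :
    ((t * (s / κ) - (b * p / κ * Real.exp (-(b * p / κ)) * (Real.exp t - 1)) : ℝ) : EReal)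
      ≤ auxJ b p κ a s := by
  refine le_sInf ?_
  rintro h ⟨μ, hμ, h1, h2, rfl⟩
  have := aux_relEnt_lb μ (poissonPMF (b * p / κ))
    (fun x => t * (if x = 1 then (1:ℝ) else 0)) (t * (s / κ)) _ hμ (fun x => aux_pois_nonneg hl _)
    ?_ (aux_pois_ind_exp _ t)
  · simpa using this
  · have h3 := (aux_ind μ).mul_left t
    rw [h2] at h3
    simpa only [mul_assoc] using h3

theorem aux_log_lb {x y : ℝ} (hx : 0 < x) (hy : 0 < y) : x - y ≤ x * Real.log (x / y) := by
  have h := Real.one_sub_inv_le_log_of_pos (div_pos hx hy)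
  have h2 := mul_le_mul_of_nonneg_left h hx.le
  have h3 : x * (1 - (x / y)⁻¹) = x - y := by field_simp
  linarith

theorem aux_log_eq {x y : ℝ} (hx : 0 < x) (hy : 0 < y) (h : x * Real.log (x / y) ≤ x - y) :
    x = y := by
  by_contra hne
  have h1 : (x / y)⁻¹ ≠ 1 := by
    rw [inv_div]; intro h'; rw [div_eq_one_iff_eq hx.ne'] at h'; exact hne h'.symm
  have h := Real.log_lt_sub_one_of_pos (inv_pos.2 (div_pos hx hy)) h1
  rw [Real.log_inv] at h
  have h2 := mul_lt_mul_of_pos_left h hx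
  have h3 : x * ((x / y)⁻¹ - 1) = y - x := by field_simp
  linarith

theorem aux_G_key {b p : ℝ} {κ : ℕ} (hb : 0 < b) (hp : p ∈ Set.Ioo (0:ℝ) 1) (hκ : 0 < κ)
    (a s r : ℝ) (ha : a ∈ Set.Ioo 0 b) (hr : auxJ b p κ a s = r) :
    a * Real.log (a / (b * p)) + (b - a) * Real.log ((b - a) / (b * (1 - p))) ≤
      κ * r + (a - b * p + (b - a) * Real.log ((1 - a / b) / (1 - p))) := by
  obtain ⟨hp0, hp1⟩ := hp
  obtain ⟨ha0, hab⟩ := ha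
  have hk : (0:ℝ) < κ := by exact_mod_cast hκ
  have h1 := aux_G_lb1 (b := b) (p := p) (κ := κ) (by positivity) a s (Real.log (a / (b * p)))
  rw [hr, EReal.coe_le_coe_iff, Real.exp_log (by positivity)] at h1
  have h2 := mul_le_mul_of_nonneg_left h1 hk.le
  have h3 : (κ:ℝ) * (Real.log (a / (b * p)) * (a / κ) - b * p / κ * (a / (b * p) - 1))
      = a * Real.log (a / (b * p)) - (a - b * p) := by
    field_simp
  have h4 : (b - a) / (b * (1 - p)) = (1 - a / b) / (1 - p) := by
    have : 1 - p ≠ 0 := by linarith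
    field_simp
  rw [h4]
  linarith

theorem aux_J_nonneg {b p : ℝ} {κ : ℕ} (hl : 0 ≤ b * p / κ) (a s : ℝ) : 0 ≤ auxJ b p κ a s := by
  simpa using aux_G_lb1 hl a s 0

theorem aux_IG (b p : ℝ) (κ : ℕ) (a s : ℝ) : IGMC b p κ a s =
    (κ : EReal) * auxJ b p κ a s
      + ((a - b * p + (b - a) * Real.log ((1 - a / b) / (1 - p)) : ℝ) : EReal) := rfl

theorem aux_IG_top {b p : ℝ} {κ : ℕ} (hκ : 0 < κ) {a s : ℝ} (h : auxJ b p κ a s = ⊤) :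
    IGMC b p κ a s = ⊤ := by
  have hk : (0:ℝ) < κ := by exact_mod_cast hκ
  rw [aux_IG, h, ← EReal.coe_natCast, EReal.coe_mul_top_of_pos hk, EReal.top_add_coe]

theorem aux_IG_real {b p : ℝ} {κ : ℕ} {a s r : ℝ} (h : auxJ b p κ a s = r) :
    IGMC b p κ a s =
      ((κ * r + (a - b * p + (b - a) * Real.log ((1 - a / b) / (1 - p))) : ℝ) : EReal) := by
  rw [aux_IG, h, ← EReal.coe_natCast]
  norm_cast

theorem aux_J_cases {b p : ℝ} {κ : ℕ} (hl : 0 ≤ b * p / κ) (a s : ℝ) :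
    auxJ b p κ a s = ⊤ ∨ ∃ r : ℝ, auxJ b p κ a s = r := by
  have h := aux_J_nonneg hl a s
  generalize auxJ b p κ a s = J at *
  induction J with
  | bot => simp at h
  | top => exact Or.inl rfl
  | coe r => exact Or.inr ⟨r, rfl⟩

/-- The rate functions `I_{L,MC}` and `I_{G,MC}` are nonnegative and vanish exactly at
the point `(pb, pb·e^{−bp/κ})`; in particular this pair is the unique minimizer of both
rate functions. -/
theorem rate_function_MC_unique_minimizer (b p : ℝ) (hb : 0 < b)
    (hp : p ∈ Set.Ioo (0 : ℝ) 1) (κ : ℕ) (hκ : 0 < κ) :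
    (∀ a s : ℝ, 0 ≤ ILMC b p κ a s) ∧
    (∀ a s : ℝ, a ∈ Set.Ioo 0 b → 0 ≤ IGMC b p κ a s) ∧
    (∀ a s : ℝ, ILMC b p κ a s = 0 ↔
      (a, s) = (p * b, p * b * Real.exp (-(b * p / κ)))) ∧
    (∀ a s : ℝ, a ∈ Set.Ioo 0 b → (IGMC b p κ a s = 0 ↔
      (a, s) = (p * b, p * b * Real.exp (-(b * p / κ))))) := by
  obtain ⟨hp0, hp1⟩ := id hp
  have hk : (0:ℝ) < κ := by exact_mod_cast hκ
  have hl : 0 ≤ b * p / κ := by positivity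
  have hkl : (κ:ℝ) * (b * p / κ) = p * b := by field_simp
  have hL0 : ∀ a s : ℝ, 0 ≤ ILMC b p κ a s := fun a s => by simpa using aux_L_lb1 hl a s 0
  refine ⟨hL0, ?_, ?_, ?_⟩
  · intro a s ha
    rcases aux_J_cases hl a s with h | ⟨r, h⟩
    · rw [aux_IG_top hκ h]; exact le_top
    · have h1 := aux_G_key hb hp hκ a s r ha h
      have h2 := aux_log_lb ha.1 (mul_pos hb hp0)
      have h3 := aux_log_lb (sub_pos.2 ha.2) (mul_pos hb (sub_pos.2 hp1))
      rw [aux_IG_real h]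
      have : (0:ℝ) ≤ κ * r + (a - b * p + (b - a) * Real.log ((1 - a / b) / (1 - p))) := by
        linarith
      exact_mod_cast this
  · intro a s
    constructor
    · intro h
      have h1 : a = p * b := by
        refine aux_deriv (fun t => Real.exp (b * p / κ * (Real.exp t - 1)) ^ κ - 1) a _ (by simp)
          ?_ (fun t => ?_)
        · have := ((((Real.hasDerivAt_exp 0).sub_const 1).const_mul (b * p / κ)).exp.fun_pow κ).sub_const 1
          refine this.congr_deriv ?_
          simp [hkl]
        · have := aux_L_lb1 hl a s t
          rw [h] at this
          have : t * a - (Real.exp (b * p / κ * (Real.exp t - 1)) ^ κ - 1) ≤ 0 := by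
            exact_mod_cast this
          linarith
      have h2 : s = p * b * Real.exp (-(b * p / κ)) := by
        refine aux_deriv (fun t => (1 + b * p / κ * Real.exp (-(b * p / κ)) * (Real.exp t - 1)) ^ κ - 1)
          s _ (by simp) ?_ (fun t => ?_)
        · have := (((((Real.hasDerivAt_exp 0).sub_const 1).const_mul
            (b * p / κ * Real.exp (-(b * p / κ)))).const_add 1).fun_pow κ).sub_const 1
          refine this.congr_deriv ?_
          simp [← hkl, mul_assoc]
        · have := aux_L_lb2 hl a s t
          rw [h] at this
          have : t * s - ((1 + b * p / κ * Real.exp (-(b * p / κ)) * (Real.exp t - 1)) ^ κ - 1) ≤ 0 := by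
            exact_mod_cast this
          linarith
      rw [h1, h2]
    · intro h
      obtain ⟨rfl, rfl⟩ := Prod.mk.inj h
      refine le_antisymm ?_ (hL0 _ _)
      refine sInf_le ⟨_, aux_M_pmf hl κ, fun x hx => aux_M_supp _ _ _ _ hx, ?_, ?_,
        (aux_relEnt_self _).symm⟩
      · rw [← hkl]; exact aux_M_mean1 hl κ
      · rw [← hkl, mul_assoc]; exact aux_M_mean2 hl κ
  · intro a s ha
    constructor
    · intro h0
      rcases aux_J_cases hl a s with h | ⟨r, h⟩
      · rw [aux_IG_top hκ h] at h0; simp at h0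
      · have h1 := aux_G_key hb hp hκ a s r ha h
        have h2 := aux_log_lb ha.1 (mul_pos hb hp0)
        have h3 := aux_log_lb (sub_pos.2 ha.2) (mul_pos hb (sub_pos.2 hp1))
        rw [aux_IG_real h] at h0
        have h0' : κ * r + (a - b * p + (b - a) * Real.log ((1 - a / b) / (1 - p))) = 0 := by
          exact_mod_cast h0
        have h4 : a = b * p := aux_log_eq ha.1 (mul_pos hb hp0) (by linarith)
        have h5 : (1 - a / b) / (1 - p) = 1 := by
          rw [h4, mul_div_cancel_left₀ _ hb.ne', div_self (by linarith)]
        rw [h5, Real.log_one, h4] at h0'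
        have hr : r = 0 := by
          have : (κ:ℝ) * r = 0 := by linarith
          exact (mul_eq_zero.1 this).resolve_left hk.ne'
        have h6 : s / κ = b * p / κ * Real.exp (-(b * p / κ)) := by
          refine aux_deriv (fun t => b * p / κ * Real.exp (-(b * p / κ)) * (Real.exp t - 1))
            _ _ (by simp) ?_ (fun t => ?_)
          · have := (((Real.hasDerivAt_exp 0).sub_const 1).const_mul
              (b * p / κ * Real.exp (-(b * p / κ))))
            refine this.congr_deriv ?_
            simp
          · have := aux_G_lb2 hl a s t
            rw [h, hr, EReal.coe_le_coe_iff] at this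
            linarith
        have h7 : s = p * b * Real.exp (-(b * p / κ)) := by
          rw [← hkl, mul_assoc, ← h6]; field_simp
        rw [← h7, h4, mul_comm b p]
    · intro h
      obtain ⟨rfl, rfl⟩ := Prod.mk.inj h
      have hJ : auxJ b p κ (p * b) (p * b * Real.exp (-(b * p / κ))) = ((0:ℝ) : EReal) := by
        refine le_antisymm ?_ (aux_J_nonneg hl _ _)
        refine sInf_le ⟨poissonPMF (b * p / κ), ⟨fun n => aux_pois_nonneg hl n, aux_pois_sum _⟩,
          ?_, ?_, (aux_relEnt_self _).symm⟩
        · rw [mul_comm p b]; exact aux_pois_mean _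
        · rw [aux_pois_one]; ring
      rw [aux_IG_real hJ]
      have h5 : (1 - p * b / b) / (1 - p) = 1 := by
        rw [mul_div_cancel_right₀ _ hb.ne', div_self (by linarith)]
      rw [h5, Real.log_one]
      rw [← EReal.coe_zero]
      congr 1
      ring
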